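/- arXiv:2411.04716 — 2 statements merged into one kernel-verified Lean document; each statement's English description precedes it below -/
import Mathlib

section
/- Let M be a countable set and G ≤ Sym(M) a permutation group all of whose orbits on M are infinite. Let Ω = [0,1]^M carry the product σ-algebra and the shift action (g·ω)(a) = ω(g⁻¹·a), and let μ be a G-invariant Borel probability measure on Ω. Then every G-invariant event lies in the tail σ-field up to null sets: if E is measurable and μ(g·E △ E) = 0 for all g ∈ G, then there is a T₀-measurable event E' with μ(E △ E') = 0. -/
open MeasureTheory ProbabilityTheory

/-- The shift action of a permutation `g` of `M` on configurations `ω : M → [0,1]`: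
`(g · ω)(a) = ω (g⁻¹ a)`. -/
def shiftAct {M : Type*} (g : Equiv.Perm M) (ω : M → unitInterval) : M → unitInterval :=
  fun a => ω (g⁻¹ a)

/-- The σ-field generated by the coordinate projection `ξ_a`. -/
def coordField {M : Type*} (a : M) : MeasurableSpace (M → unitInterval) :=
  MeasurableSpace.comap (fun ω => ω a) inferInstance

/-- The tail σ-field `T₀ = ⋂ {σ(ξ_a : a ∉ A) : A finite}`. -/
def tailField (M : Type*) : MeasurableSpace (M → unitInterval) :=
  ⨅ A : Finset M, ⨆ (a : M) (_ : a ∉ A), coordField a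

open scoped Pointwise in
/-- **Neumann's separation lemma**: if all orbits of a permutation group are infinite, then any
finite set can be moved off any other finite set. -/
theorem exists_mem_forall_apply_notMem_of_infinite_orbits {M : Type*}
    (G : Subgroup (Equiv.Perm M)) (horb : ∀ b : M, {c : M | ∃ g ∈ G, g b = c}.Infinite)
    (A B : Finset M) : ∃ g ∈ G, ∀ b ∈ B, g b ∉ A := by
  classical
  by_contra! hmeet
  let t : Finset (M × M) := {p ∈ B ×ˢ A | ∃ g : G, (g : Equiv.Perm M) p.1 = p.2}
  have ht : ∀ p : M × M, ∃ g : G, p ∈ t → (g : Equiv.Perm M) p.1 = p.2 := by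
    intro p
    by_cases hp : p ∈ t
    · obtain ⟨g, hg⟩ := (Finset.mem_filter.1 hp).2
      exact ⟨g, fun _ => hg⟩
    · exact ⟨1, fun h => absurd h hp⟩
  choose γ hγ using ht
  have hcover : ⋃ p ∈ t, γ p • (MulAction.stabilizer G p.1 : Set G) = Set.univ := by
    refine Set.eq_univ_of_forall fun g => ?_
    obtain ⟨b, hb, hgb⟩ := hmeet g g.2
    have hp : (b, (g : Equiv.Perm M) b) ∈ t :=
      Finset.mem_filter.2 ⟨Finset.mem_product.2 ⟨hb, hgb⟩, g, rfl⟩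
    refine Set.mem_iUnion₂.2 ⟨_, hp, ?_⟩
    rw [mem_leftCoset_iff, SetLike.mem_coe, MulAction.mem_stabilizer_iff, mul_smul,
      inv_smul_eq_iff]
    exact (hγ _ hp).symm
  obtain ⟨p, -, hfin⟩ := Subgroup.exists_finiteIndex_of_leftCoset_cover hcover
  have : Finite (G ⧸ MulAction.stabilizer G p.1) := Subgroup.finite_quotient_of_finiteIndex
  have : Finite (MulAction.orbit G p.1) :=
    Finite.of_equiv _ (MulAction.orbitEquivQuotientStabilizer G p.1).symm
  refine horb p.1 ((Set.toFinite (MulAction.orbit G p.1)).subset ?_)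
  rintro c ⟨g, hg, rfl⟩
  exact ⟨⟨g, hg⟩, rfl⟩

/-- Shifts are measurable. -/
theorem measurable_shiftAct {M : Type*} (g : Equiv.Perm M) :
    Measurable (shiftAct g : (M → unitInterval) → M → unitInterval) :=
  measurable_pi_lambda _ fun a => measurable_pi_apply (g⁻¹ a)

/-- Measurable cylinders are dense among the measurable sets for a finite measure. -/
theorem exists_mem_measurableCylinders_measure_symmDiff_lt {ι : Type*} {α : ι → Type*}
    [∀ i, MeasurableSpace (α i)] (μ : Measure (∀ i, α i)) [IsFiniteMeasure μ]
    {s : Set (∀ i, α i)} (hs : MeasurableSet s) {ε : ENNReal} (hε : 0 < ε) :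
    ∃ t ∈ measurableCylinders α, μ (symmDiff t s) < ε :=
  exists_measure_symmDiff_lt_of_generateFrom_isSetRing
    isSetRing_measurableCylinders
    ⟨{Set.univ}, Set.countable_singleton _,
      Set.singleton_subset_iff.2 (univ_mem_measurableCylinders α), by simp⟩
    generateFrom_measurableCylinders.symm hs hε

/-- If a permutation `g⁻¹` moves the base of a cylinder off `A`, then the shift by `g` of the
cylinder depends only on the coordinates outside `A`. -/
theorem measurableSet_shiftAct_preimage_cylinder {M : Type*} (g : Equiv.Perm M) (A B : Finset M)
    (hg : ∀ b ∈ B, g⁻¹ b ∉ A) {S : Set (B → unitInterval)} (hS : MeasurableSet S) :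
    MeasurableSet[⨆ (a : M) (_ : a ∉ A), coordField a] (shiftAct g ⁻¹' cylinder B S) := by
  have hmeas : @Measurable _ _ (⨆ (a : M) (_ : a ∉ A), coordField a) MeasurableSpace.pi
      fun (ω : M → unitInterval) (b : B) => ω (g⁻¹ b) := by
    refine @measurable_pi_lambda _ _ _ (_) _ _ fun b => ?_
    refine Measurable.mono (comap_measurable fun ω : M → unitInterval => ω (g⁻¹ b)) ?_ le_rfl
    exact le_iSup₂_of_le (g⁻¹ b) (hg b b.2) le_rfl
  exact hmeas hS

/-- An invariant event is approximated arbitrarily well by events that do not depend on a given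
finite set of coordinates. -/
theorem exists_measurableSet_coord_compl_measure_symmDiff_lt {M : Type*}
    (G : Subgroup (Equiv.Perm M)) (horb : ∀ b : M, {c : M | ∃ g ∈ G, g b = c}.Infinite)
    (μ : Measure (M → unitInterval)) [IsFiniteMeasure μ]
    (hinv : ∀ g ∈ G, μ.map (shiftAct g) = μ)
    {E : Set (M → unitInterval)} (hE : MeasurableSet E)
    (hEinv : ∀ g ∈ G, μ (symmDiff (shiftAct g ⁻¹' E) E) = 0)
    (A : Finset M) {ε : ENNReal} (hε : 0 < ε) :
    ∃ F : Set (M → unitInterval),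
      MeasurableSet[⨆ (a : M) (_ : a ∉ A), coordField a] F ∧ μ (symmDiff F E) < ε := by
  obtain ⟨C, hC, hCE⟩ := exists_mem_measurableCylinders_measure_symmDiff_lt μ hE hε
  obtain ⟨B, S, hS, rfl⟩ := (mem_measurableCylinders C).1 hC
  obtain ⟨h, hG, hdisj⟩ := exists_mem_forall_apply_notMem_of_infinite_orbits G horb A B
  have hG' : h⁻¹ ∈ G := G.inv_mem hG
  refine ⟨shiftAct h⁻¹ ⁻¹' cylinder B S,
    measurableSet_shiftAct_preimage_cylinder _ A B (by simpa using hdisj) hS, ?_⟩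
  have hmp : MeasurePreserving (shiftAct h⁻¹) μ μ := ⟨measurable_shiftAct _, hinv _ hG'⟩
  calc μ (symmDiff (shiftAct h⁻¹ ⁻¹' cylinder B S) E)
      ≤ μ (symmDiff (shiftAct h⁻¹ ⁻¹' cylinder B S) (shiftAct h⁻¹ ⁻¹' E))
        + μ (symmDiff (shiftAct h⁻¹ ⁻¹' E) E) := measure_symmDiff_le _ _ _
    _ = μ (shiftAct h⁻¹ ⁻¹' symmDiff (cylinder B S) E) := by
        rw [hEinv _ hG', add_zero, Set.preimage_symmDiff]
    _ = μ (symmDiff (cylinder B S) E) :=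
        hmp.measure_preimage (hS.cylinder.symmDiff hE).nullMeasurableSet
    _ < ε := hCE

/-- The limit superior of a sequence of events that eventually do not depend on any given finite
set of coordinates is a tail event. -/
theorem measurableSet_tailField_limsup {M : Type*} {A : ℕ → Finset M}
    (hA : Filter.Tendsto A Filter.atTop Filter.atTop) {F : ℕ → Set (M → unitInterval)}
    (hF : ∀ n, MeasurableSet[⨆ (a : M) (_ : a ∉ A n), coordField a] (F n)) :
    MeasurableSet[tailField M] (Filter.limsup F Filter.atTop) := by
  rw [tailField, MeasurableSpace.measurableSet_iInf]
  intro A₀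
  obtain ⟨N, hN⟩ := Filter.eventually_atTop.1 (hA.eventually_ge_atTop A₀)
  rw [← Filter.limsup_nat_add F N]
  refine @MeasurableSet.measurableSet_limsup _ (_) _ fun n => ?_
  have hle : (⨆ (a : M) (_ : a ∉ A (n + N)), coordField a) ≤
      (⨆ (a : M) (_ : a ∉ A₀), coordField a : MeasurableSpace (M → unitInterval)) :=
    biSup_mono fun a ha h => ha (hN (n + N) (Nat.le_add_left N n) h)
  exact hle _ (hF (n + N))

/-- if all orbits of `G` on `M` are infinite and `μ` is a `G`-invariant
probability measure on `[0,1]^M`, then every `G`-invariant event lies in the tail σ-field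
up to null sets. -/
theorem invariant_event_mem_tail_ae
    {M : Type*} [Countable M] (G : Subgroup (Equiv.Perm M))
    (horb : ∀ b : M, {c : M | ∃ g ∈ G, g b = c}.Infinite)
    (μ : Measure (M → unitInterval)) [IsProbabilityMeasure μ]
    (hinv : ∀ g ∈ G, μ.map (shiftAct g) = μ)
    (E : Set (M → unitInterval)) (hE : MeasurableSet E)
    (hEinv : ∀ g ∈ G, μ (symmDiff (shiftAct g ⁻¹' E) E) = 0) :
    ∃ E' : Set (M → unitInterval), MeasurableSet[tailField M] E' ∧ μ (symmDiff E E') = 0 := by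
  obtain ⟨A, hA⟩ := Filter.exists_seq_tendsto (Filter.atTop : Filter (Finset M))
  obtain ⟨ε, hε, hsum⟩ := ENNReal.exists_pos_sum_of_countable' one_ne_zero ℕ
  choose F hF hFE using fun n =>
    exists_measurableSet_coord_compl_measure_symmDiff_lt G horb μ hinv hE hEinv (A n) (hε n)
  refine ⟨Filter.limsup F Filter.atTop, measurableSet_tailField_limsup hA hF, ?_⟩
  have hfin : ∑' n, μ (symmDiff (F n) E) ≠ ⊤ :=
    ((ENNReal.tsum_le_tsum fun n => (hFE n).le).trans_lt (hsum.trans ENNReal.one_lt_top)).ne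
  rw [measure_symmDiff_eq_zero_iff, Filter.eventuallyEq_set]
  filter_upwards [ae_eventually_notMem hfin] with ω hω
  have hiff : ∀ᶠ n in Filter.atTop, (ω ∈ F n ↔ ω ∈ E) := by
    filter_upwards [hω] with n hn
    rw [Set.mem_symmDiff] at hn
    tauto
  rw [Filter.mem_limsup_iff_frequently_mem, Filter.frequently_congr hiff, Filter.frequently_const]
end

section
/- Let M be a countable set and G ≤ Sym(M) a permutation group with no algebraicity such that for every a ∈ M the stabilizer G_a is a maximal subgroup of G, and suppose G ↷ M has uniform non-algebraicity. Let Ω = [0,1]^M carry the product σ-algebra and the shift action, and let μ be a G-invariant Borel probability measure on Ω. Then the family of coordinate σ-fields (σ(ξ_a))_{a∈M} is conditionally independent, under μ, given the invariant σ-field J := {E measurable : μ(g·E △ E) = 0 for all g ∈ G}. -/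
open MeasureTheory ProbabilityTheory

/-- The invariant σ-field `J` of events invariant mod `μ`-null sets under the shift action
of `G`. -/
def invariantField {M : Type*} (G : Subgroup (Equiv.Perm M))
    (μ : Measure (M → unitInterval)) : MeasurableSpace (M → unitInterval) :=
  MeasurableSpace.generateFrom
    {E : Set (M → unitInterval) | MeasurableSet E ∧
      ∀ g ∈ G, μ (symmDiff (shiftAct g ⁻¹' E) E) = 0}

lemma invariantField_le {M : Type*} (G : Subgroup (Equiv.Perm M))
    (μ : Measure (M → unitInterval)) :
    invariantField G μ ≤ (inferInstance : MeasurableSpace (M → unitInterval)) :=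
  MeasurableSpace.generateFrom_le fun _ hs => hs.1

/-- `(b̄, a)` and `(b̄', a')` have the same type: every finite initial subtuple of the first
can be mapped to the corresponding subtuple of the second by an element of `G`. -/
def SameTypeExt {M : Type*} (G : Subgroup (Equiv.Perm M)) (b b' : ℕ → M) (a a' : M) :
    Prop :=
  ∀ n : ℕ, ∃ g ∈ G, (∀ i < n, g (b i) = b' i) ∧ g a = a'

/-- `G ↷ M` has uniform non-algebraicity: for every tuple `b̄` and every `a` not in `b̄`,
there are `b̄'` and `a' ≠ a''` with `tp(b̄'a') = tp(b̄'a'') = tp(b̄a)`. -/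
def UniformNonAlgebraicity {M : Type*} (G : Subgroup (Equiv.Perm M)) : Prop :=
  ∀ (b : ℕ → M) (a : M), (∀ i, b i ≠ a) →
    ∃ (b' : ℕ → M) (a' a'' : M), a' ≠ a'' ∧
      SameTypeExt G b b' a a' ∧ SameTypeExt G b b' a a''

open Filter Set
open scoped ENNReal symmDiff

section Abstract

variable {Ω : Type*} {m J m₀ : MeasurableSpace Ω} {μ : Measure Ω}

/-- Conditional expectation commutes with pulling back along a measure preserving map. -/
lemma MeasureTheory.MeasurePreserving.condExp_comp [IsFiniteMeasure μ] (hm : m ≤ m₀) {R : Ω → Ω}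
    (hR : MeasurePreserving R μ μ) {f : Ω → ℝ} (hf : Integrable f μ) :
    μ[f | m] ∘ R =ᵐ[μ] μ[f ∘ R | m.comap R] := by
  have hle : m.comap R ≤ m₀ := (MeasurableSpace.comap_mono hm).trans hR.measurable.comap_le
  refine ae_eq_condExp_of_forall_setIntegral_eq hle (hR.integrable_comp_of_integrable hf)
    (fun _ _ _ => (hR.integrable_comp_of_integrable integrable_condExp).integrableOn) ?_
    (stronglyMeasurable_condExp.comp_measurable (comap_measurable R)).aestronglyMeasurable
  rintro _ ⟨t, ht, rfl⟩ -
  have key (u : Ω → ℝ) (hu : Integrable u μ) : ∫ x in R ⁻¹' t, u (R x) ∂μ = ∫ y in t, u y ∂μ := by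
    conv_rhs => rw [← hR.map_eq]
    exact (setIntegral_map (hm t ht) (by rw [hR.map_eq]; exact hu.aestronglyMeasurable)
      hR.aemeasurable).symm
  simp only [Function.comp_apply]
  rw [key _ integrable_condExp, key _ hf, setIntegral_condExp hm hf ht]

/-- A square integrable function whose conditional expectation has the same second moment is
equal to its conditional expectation. -/
lemma condExp_ae_eq_self_of_integral_sq_eq [IsFiniteMeasure μ] (hm : m ≤ m₀) {f : Ω → ℝ}
    (hf : MemLp f 2 μ) (h : ∫ x, (μ[f | m]) x ^ 2 ∂μ = ∫ x, f x ^ 2 ∂μ) : μ[f | m] =ᵐ[μ] f := by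
  have hint : Integrable ((f - μ[f | m]) ^ 2) μ := (hf.sub (hf.condExp one_le_two)).integrable_sq
  have h0 : ∫ x, ((f - μ[f | m]) ^ 2) x ∂μ = 0 := by
    rw [← integral_condExp hm]
    have hv := integral_congr_ae (condVar_ae_eq_condExp_sq_sub_sq_condExp hm hf)
    rw [condVar] at hv
    rw [hv, integral_sub' integrable_condExp (show Integrable (μ[f | m] ^ 2) μ from
      (hf.condExp one_le_two).integrable_sq), integral_condExp hm]
    simp only [Pi.pow_apply]
    rw [h, sub_self]
  rw [integral_eq_zero_iff_of_nonneg (fun x => by simp only [Pi.pow_apply]; positivity) hint] at h0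
  filter_upwards [h0] with x hx
  simp only [Pi.pow_apply, Pi.sub_apply, Pi.zero_apply] at hx
  have := pow_eq_zero_iff (two_ne_zero) |>.1 hx
  linarith

/-- A set which is approximated in measure by `m`-measurable sets is `m`-measurable modulo a null
set. -/
lemma exists_measurableSet_ae_eq_of_approx {s : Set Ω}
    (h : ∀ ε : ℝ≥0∞, 0 < ε → ∃ t, MeasurableSet[m] t ∧ μ (t ∆ s) < ε) :
    ∃ t, MeasurableSet[m] t ∧ s =ᵐ[μ] t := by
  obtain ⟨δ, hδ, hsum⟩ := ENNReal.exists_pos_sum_of_countable one_ne_zero ℕ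
  choose t ht htδ using fun n => h (δ n) (by exact_mod_cast hδ n)
  refine ⟨limsup t atTop, @MeasurableSet.measurableSet_limsup _ m _ ht, ?_⟩
  have hfin : ∑' n, μ (t n ∆ s) ≠ ∞ :=
    ((ENNReal.tsum_le_tsum fun n => (htδ n).le).trans_lt (hsum.trans ENNReal.one_lt_top)).ne
  refine eventuallyEq_set.2 ?_
  filter_upwards [ae_eventually_notMem hfin] with x hx
  have hx' : ∀ᶠ n in atTop, (x ∈ t n ↔ x ∈ s) := by
    filter_upwards [hx] with n hn
    simp only [mem_symmDiff] at hn
    tauto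
  rw [mem_limsup_iff_frequently_mem,
    frequently_congr hx', frequently_const]

/-- If `J` is contained in `m` modulo null sets and the conditional probability of `A` given `m`
is `J`-measurable, then `A` is independent of `m` given `J`. -/
lemma condExp_indicator_inter_of_stronglyMeasurable [IsProbabilityMeasure μ] (hm : m ≤ m₀)
    (hJ : J ≤ m₀) (hJm : J ≤ eventuallyMeasurableSpace m (ae μ)) {A C : Set Ω}
    (hA : MeasurableSet A) (hC : MeasurableSet[m] C) (hφ : StronglyMeasurable[J] (μ⟦A | m⟧)) :
    μ⟦A ∩ C | J⟧ =ᵐ[μ] μ⟦A | J⟧ * μ⟦C | J⟧ := by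
  have key (C : Set Ω) (hC : MeasurableSet[m] C) : μ⟦A ∩ C | J⟧ =ᵐ[μ] μ⟦A | m⟧ * μ⟦C | J⟧ := by
    have hmul : μ⟦A | m⟧ * C.indicator (fun _ => (1 : ℝ)) = C.indicator (μ⟦A | m⟧) := by
      ext x; by_cases hx : x ∈ C <;> simp [hx]
    have hint : Integrable (C.indicator (μ⟦A | m⟧)) μ := integrable_condExp.indicator (hm C hC)
    have hAint : Integrable (A.indicator fun _ => (1 : ℝ)) μ := (integrable_const 1).indicator hA
    have h1 : μ⟦A ∩ C | J⟧ =ᵐ[μ] μ[C.indicator (μ⟦A | m⟧) | J] := by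
      refine ae_eq_condExp_of_forall_setIntegral_eq hJ hint
        (fun _ _ _ => integrable_condExp.integrableOn) ?_
        stronglyMeasurable_condExp.aestronglyMeasurable
      intro s hs _
      obtain ⟨t, ht, hst⟩ := hJm s hs
      rw [setIntegral_condExp hJ ((integrable_const 1).indicator (hA.inter (hm C hC))) hs,
        setIntegral_congr_set hst, setIntegral_congr_set hst, setIntegral_indicator (hm C hC),
        setIntegral_condExp hm hAint (ht.inter hC), ← setIntegral_indicator (hm C hC),
        indicator_indicator, inter_comm]
    refine h1.trans ?_
    rw [← hmul]
    exact condExp_mul_of_stronglyMeasurable_left hφ (by rwa [hmul])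
      ((integrable_const 1).indicator (hm C hC))
  have huniv := key univ MeasurableSet.univ
  filter_upwards [huniv, key C hC] with x h1 h2
  simp only [inter_univ, indicator_univ, condExp_const hJ, Pi.mul_apply, mul_one] at h1
  rw [h2, Pi.mul_apply, Pi.mul_apply, h1]

end Abstract

/-- The σ-field generated by all coordinates other than `a`. -/
@[reducible] def otherCoordsField {M : Type*} (a : M) : MeasurableSpace (M → unitInterval) :=
  MeasurableSpace.comap (fun ω (x : {x : M // x ≠ a}) => ω x) MeasurableSpace.pi

/-- The configuration `ω` read along a map of the index set. -/
def reindex {M : Type*} (τ : M → M) (ω : M → unitInterval) : M → unitInterval :=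
  fun a => ω (τ a)

/-- A map agrees on every finite set with some element of `G`. -/
def LocallyIn {M : Type*} (G : Subgroup (Equiv.Perm M)) (τ : M → M) : Prop :=
  ∀ S : Finset M, ∃ g ∈ G, ∀ x ∈ S, g x = τ x

section Action

variable {M : Type*} {G : Subgroup (Equiv.Perm M)} {μ : Measure (M → unitInterval)} {a : M}

lemma measurable_reindex (τ : M → M) : Measurable (reindex τ) :=
  measurable_pi_lambda _ fun x => measurable_pi_apply (τ x)

lemma reindex_reindex_inv (g : Equiv.Perm M) (ω : M → unitInterval) :
    reindex g (reindex ⇑g⁻¹ ω) = ω := by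
  ext x
  simp [reindex]

lemma otherCoordsField_le (a : M) : otherCoordsField a ≤ MeasurableSpace.pi :=
  Measurable.comap_le (measurable_pi_lambda _ fun x => measurable_pi_apply x.1)

lemma coordField_le (a : M) : coordField a ≤ MeasurableSpace.pi :=
  (measurable_pi_apply a).comap_le

lemma measurable_otherCoordsField_apply {a x : M} (hx : x ≠ a) :
    Measurable[otherCoordsField a] fun ω : M → unitInterval => ω x :=
  (measurable_pi_apply (⟨x, hx⟩ : {x : M // x ≠ a})).comp
    (comap_measurable (fun (ω : M → unitInterval) (x : {x : M // x ≠ a}) => ω x))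

lemma coordField_le_otherCoordsField {a x : M} (hx : x ≠ a) :
    coordField x ≤ otherCoordsField a :=
  (measurable_otherCoordsField_apply hx).comap_le

lemma comap_reindex_otherCoordsField_le {τ : M → M} (hτ : ∀ x ≠ a, τ x ≠ a) :
    (otherCoordsField a).comap (reindex τ) ≤ otherCoordsField a := by
  rw [otherCoordsField, MeasurableSpace.comap_comp]
  refine Measurable.comap_le ?_
  exact @measurable_pi_lambda _ _ _ (otherCoordsField a) _ _ fun x =>
    measurable_otherCoordsField_apply (hτ x.1 x.2)

lemma LocallyIn.of_mem {g : Equiv.Perm M} (hg : g ∈ G) : LocallyIn G g := fun _ => ⟨g, hg, by simp⟩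

lemma LocallyIn.mul_left {g : Equiv.Perm M} (hg : g ∈ G) {τ : M → M} (hτ : LocallyIn G τ) :
    LocallyIn G (g ∘ τ) := fun S => by
  obtain ⟨k, hk, h⟩ := hτ S
  exact ⟨g * k, G.mul_mem hg hk, fun x hx => by simp [h x hx]⟩

lemma LocallyIn.injective {τ : M → M} (hτ : LocallyIn G τ) : Function.Injective τ := by
  classical
  intro x y hxy
  obtain ⟨g, -, h⟩ := hτ {x, y}
  exact g.injective (by rw [h x (by simp), h y (by simp), hxy])

lemma LocallyIn.measurePreserving [IsFiniteMeasure μ] (hinv : ∀ g ∈ G, μ.map (shiftAct g) = μ)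
    {τ : M → M} (hτ : LocallyIn G τ) : MeasurePreserving (reindex τ) μ μ := by
  refine ⟨measurable_reindex τ, ?_⟩
  refine IsProjectiveLimit.unique (P := fun I : Finset M => μ.map I.restrict) ?_ fun I => rfl
  intro I
  obtain ⟨g, hg, h⟩ := hτ I
  have hgμ : μ.map (reindex g) = μ := by
    conv_rhs => rw [← hinv g⁻¹ (G.inv_mem hg)]
    congr 1
  have hr : Measurable (I.restrict (π := fun _ => unitInterval)) := Finset.measurable_restrict I
  change _ = μ.map I.restrict
  conv_rhs => rw [← hgμ]
  rw [Measure.map_map hr (measurable_reindex τ), Measure.map_map hr (measurable_reindex g)]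
  congr 1
  ext ω x
  simp [reindex, h x.1 x.2]

/-- Uniform non-algebraicity gives two maps locally in `G` which agree off `a` but not at `a`. -/
lemma UniformNonAlgebraicity.exists_locallyIn [Countable M] (huna : UniformNonAlgebraicity G)
    (hinf : ∃ x, x ≠ a) :
    ∃ τ σ : M → M, LocallyIn G τ ∧ LocallyIn G σ ∧ (∀ x ≠ a, τ x = σ x) ∧ τ a ≠ σ a := by
  classical
  have : Nonempty {x : M // x ≠ a} := ⟨⟨hinf.choose, hinf.choose_spec⟩⟩
  obtain ⟨b, hb⟩ := exists_surjective_nat {x : M // x ≠ a}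
  choose idx hidx using hb
  obtain ⟨b', c, d, hcd, hc, hd⟩ := huna (fun i => b i) a fun i => (b i).2
  let extend (c x : M) : M := if h : x ≠ a then b' (idx ⟨x, h⟩) else c
  have hext (c : M) (hc : SameTypeExt G (fun i => b i) b' a c) : LocallyIn G (extend c) := by
    intro S
    obtain ⟨N, hN⟩ := (S.image fun x => if h : x ≠ a then idx ⟨x, h⟩ else 0).exists_le
    obtain ⟨g, hg, hgb, hga⟩ := hc (N + 1)
    refine ⟨g, hg, fun x hx => ?_⟩
    by_cases h : x ≠ a
    · have hlt := hN _ (Finset.mem_image_of_mem _ hx)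
      simp only [h, ne_eq, not_false_eq_true, dite_true] at hlt
      have := hgb (idx ⟨x, h⟩) (Nat.lt_succ_of_le hlt)
      simpa [extend, h, hidx] using this
    · have hxa : x = a := not_not.1 h
      simp [extend, hxa, hga]
  exact ⟨extend c, extend d, hext c hc, hext d hd, fun x hx => by simp [extend, hx], by simpa [extend] using hcd⟩

lemma invariantField_le_eventuallyMeasurableSpace [IsFiniteMeasure μ]
    (hinv : ∀ g ∈ G, μ.map (shiftAct g) = μ) (horb : {c : M | ∃ g ∈ G, g a = c}.Infinite) :
    invariantField G μ ≤ eventuallyMeasurableSpace (otherCoordsField a) (ae μ) := by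
  refine MeasurableSpace.generateFrom_le ?_
  rintro E ⟨hE, hEinv⟩
  refine exists_measurableSet_ae_eq_of_approx fun ε hε => ?_
  obtain ⟨t, htC, htE⟩ := exists_measure_symmDiff_lt_of_generateFrom_isSetRing (μ := μ)
    (isSetRing_measurableCylinders (α := fun _ : M => unitInterval))
    ⟨{univ}, countable_singleton _, singleton_subset_iff.2 (univ_mem_measurableCylinders _), by simp⟩
    generateFrom_measurableCylinders.symm hE hε
  obtain ⟨I, T, hT, rfl⟩ := (mem_measurableCylinders _).1 htC
  obtain ⟨_, ⟨g, hg, rfl⟩, hgI⟩ := horb.exists_notMem_finset I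
  have hpres := (LocallyIn.of_mem (G.inv_mem hg)).measurePreserving hinv
  refine ⟨reindex ⇑g⁻¹ ⁻¹' cylinder I T, ?_, ?_⟩
  · have hmeas : Measurable[otherCoordsField a]
        fun (ω : M → unitInterval) => I.restrict (reindex ⇑g⁻¹ ω) := by
      refine @measurable_pi_lambda _ _ _ (otherCoordsField a) _ _ fun x =>
        measurable_otherCoordsField_apply fun h => hgI ?_
      rw [← h]
      simp
    exact hmeas hT
  · calc μ ((reindex ⇑g⁻¹ ⁻¹' cylinder I T) ∆ E)
        ≤ μ ((reindex ⇑g⁻¹ ⁻¹' cylinder I T) ∆ (reindex ⇑g⁻¹ ⁻¹' E))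
          + μ ((reindex ⇑g⁻¹ ⁻¹' E) ∆ E) := measure_symmDiff_le _ _ _
      _ = μ (cylinder I T ∆ E) := by
        rw [show μ ((reindex ⇑g⁻¹ ⁻¹' E) ∆ E) = 0 from hEinv g hg, add_zero, ← preimage_symmDiff,
          hpres.measure_preimage ((hT.cylinder).symmDiff hE).nullMeasurableSet]
      _ < ε := htE

/-- The conditional probability of an event of the coordinate `a` given the other coordinates is
fixed by the maps locally in `G` which fix `a`. -/
lemma condExp_otherCoordsField_comp_reindex [IsProbabilityMeasure μ]
    (hinv : ∀ g ∈ G, μ.map (shiftAct g) = μ) {A : Set (M → unitInterval)}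
    (hA : MeasurableSet[coordField a] A) {τ : M → M} (hτ : LocallyIn G τ) (hτa : τ a = a) :
    μ⟦A | otherCoordsField a⟧ ∘ reindex τ =ᵐ[μ] μ⟦A | otherCoordsField a⟧ := by
  set φ := μ⟦A | otherCoordsField a⟧
  have hpres := hτ.measurePreserving hinv
  have hA₀ := coordField_le a A hA
  have hLp : MemLp (A.indicator fun _ => (1 : ℝ)) 2 μ := (memLp_const 1).indicator hA₀
  have hle := comap_reindex_otherCoordsField_le (a := a) (τ := τ)
    fun x hx h => hx (hτ.injective (h.trans hτa.symm))
  have hAτ : (A.indicator fun _ => (1 : ℝ)) ∘ reindex τ = A.indicator fun _ => (1 : ℝ) := by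
    obtain ⟨T, -, rfl⟩ := hA
    ext ω
    have hω : reindex τ ω a = ω a := congrArg ω hτa
    change T.indicator (fun _ => (1 : ℝ)) (reindex τ ω a) = T.indicator (fun _ => 1) (ω a)
    rw [hω]
  have h1 := hpres.condExp_comp (otherCoordsField_le a) (hLp.integrable one_le_two)
  rw [hAτ] at h1
  have h2 := h1.trans (condExp_condExp_of_le hle (otherCoordsField_le a)).symm
  refine h2.trans (condExp_ae_eq_self_of_integral_sq_eq (hle.trans (otherCoordsField_le a))
    (hLp.condExp one_le_two) ?_)
  have h3 : ∫ x, φ (reindex τ x) ^ 2 ∂μ = ∫ x, φ x ^ 2 ∂μ := by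
    conv_rhs => rw [← hpres.map_eq]
    exact (integral_map hpres.aemeasurable (by
      rw [hpres.map_eq]
      exact (integrable_condExp.aestronglyMeasurable (f := φ)).pow 2)).symm
  rw [← h3]
  refine integral_congr_ae ?_
  filter_upwards [h2] with x hx
  rw [← hx, Function.comp_apply]

lemma condExp_otherCoordsField_comp_shiftAct [Countable M] [IsProbabilityMeasure μ]
    (hinv : ∀ g ∈ G, μ.map (shiftAct g) = μ) (hmax : IsCoatom (MulAction.stabilizer G a))
    (huna : UniformNonAlgebraicity G) (hinf : ∃ x, x ≠ a) {A : Set (M → unitInterval)}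
    (hA : MeasurableSet[coordField a] A) {g : Equiv.Perm M} (hg : g ∈ G) :
    μ⟦A | otherCoordsField a⟧ ∘ reindex g =ᵐ[μ] μ⟦A | otherCoordsField a⟧ := by
  set φ := μ⟦A | otherCoordsField a⟧ with hφ
  have hpres {τ : M → M} (hτ : LocallyIn G τ) := hτ.measurePreserving hinv
  let H : Subgroup G :=
    { carrier := {g | φ ∘ reindex (g : Equiv.Perm M) =ᵐ[μ] φ}
      one_mem' := ae_of_all _ fun _ => rfl
      mul_mem' := fun {g k} hg hk =>
        EventuallyEq.trans
          ((hpres (.of_mem g.2)).quasiMeasurePreserving.ae_eq_comp hk) hg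
      inv_mem' := fun {g} hg => by
        have h := (hpres (.of_mem (G.inv_mem g.2))).quasiMeasurePreserving.ae_eq_comp hg
        refine EventuallyEq.trans h.symm (ae_of_all _ fun ω => ?_)
        simp only [Function.comp_apply, reindex_reindex_inv] }
  have hfix {τ : M → M} (hτ : LocallyIn G τ) (hτa : τ a = a) : φ ∘ reindex τ =ᵐ[μ] φ :=
    condExp_otherCoordsField_comp_reindex hinv hA hτ hτa
  have hmove {τ : M → M} (hτ : LocallyIn G τ) {g : Equiv.Perm M} (hg : g ∈ G) (hga : g a = τ a) :
      φ ∘ reindex τ =ᵐ[μ] φ ∘ reindex g := by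
    have h := hfix (hτ.mul_left (G.inv_mem hg)) (by simp [← hga])
    refine EventuallyEq.trans (ae_of_all _ fun ω => ?_)
      ((hpres (.of_mem hg)).quasiMeasurePreserving.ae_eq_comp h)
    simp only [Function.comp_apply]
    congr 1
    ext x
    simp [reindex]
  obtain ⟨τ, σ, hτ, hσ, hτσ, hne⟩ := huna.exists_locallyIn hinf
  obtain ⟨g₁, hg₁, hgτ⟩ := hτ {a}
  obtain ⟨g₂, hg₂, hgσ⟩ := hσ {a}
  simp only [Finset.mem_singleton, forall_eq] at hgτ hgσ
  have hdep : φ ∘ reindex τ = φ ∘ reindex σ := by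
    have hmeas : Measurable[otherCoordsField a] φ := stronglyMeasurable_condExp.measurable
    obtain ⟨ψ, -, hψ⟩ := hmeas.exists_eq_measurable_comp
    ext ω
    simp only [hψ, Function.comp_apply]
    congr 1
    ext x
    simp [reindex, hτσ x.1 x.2]
  have h12 : φ ∘ reindex g₁ =ᵐ[μ] φ ∘ reindex g₂ :=
    ((hmove hτ hg₁ hgτ).symm.trans (hdep ▸ EventuallyEq.rfl)).trans (hmove hσ hg₂ hgσ)
  have hH : H = ⊤ := by
    refine hmax.2 H (lt_of_le_of_ne (fun k hk => hfix (.of_mem k.2) hk) fun heq => ?_)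
    have hmem : (⟨g₁⁻¹ * g₂, G.mul_mem (G.inv_mem hg₁) hg₂⟩ : G) ∈ H := by
      have h := (hpres (.of_mem (G.inv_mem hg₁))).quasiMeasurePreserving.ae_eq_comp h12
      refine EventuallyEq.trans (EventuallyEq.trans ?_ h.symm) (ae_of_all _ fun ω => ?_)
      · exact ae_of_all _ fun ω => rfl
      · simp only [Function.comp_apply, reindex_reindex_inv]
    rw [← heq, MulAction.mem_stabilizer_iff] at hmem
    have h : g₁⁻¹ (g₂ a) = a := hmem
    rw [Equiv.Perm.inv_eq_iff_eq] at h
    exact hne (by rw [← hgτ, ← hgσ, h])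
  have hgH : (⟨g, hg⟩ : G) ∈ H := hH ▸ Subgroup.mem_top _
  exact hgH

/-- A measurable function invariant modulo null sets is measurable for the invariant σ-field. -/
lemma measurable_invariantField {f : (M → unitInterval) → ℝ} (hf : Measurable f)
    (h : ∀ g ∈ G, f ∘ shiftAct g =ᵐ[μ] f) : Measurable[invariantField G μ] f := by
  intro U hU
  refine MeasurableSpace.measurableSet_generateFrom ⟨hf hU, fun g hg => ?_⟩
  rw [measure_symmDiff_eq_zero_iff]
  refine eventuallyEq_set.2 ?_
  filter_upwards [h g hg] with ω hω
  simp only [mem_preimage, ← hω, Function.comp_apply]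

end Action

/-- if `G ≤ Sym(M)` has no algebraicity, all point stabilizers are maximal
subgroups, and `G ↷ M` has uniform non-algebraicity, then for every `G`-invariant
probability measure on `[0,1]^M`, the coordinate σ-fields are conditionally independent
given the invariant σ-field `J`. -/
theorem coordFields_condIndep_given_invariantField
    {M : Type*} [Countable M] (G : Subgroup (Equiv.Perm M))
    (hnoalg : ∀ A : Set M, A.Finite → ∀ b ∉ A,
      {c : M | ∃ g ∈ G, (∀ a ∈ A, g a = a) ∧ g b = c}.Infinite)
    (hmax : ∀ a : M, IsCoatom (MulAction.stabilizer G a))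
    (huna : UniformNonAlgebraicity G)
    (μ : Measure (M → unitInterval)) [IsProbabilityMeasure μ]
    (hinv : ∀ g ∈ G, μ.map (shiftAct g) = μ) :
    iCondIndep (invariantField G μ) (invariantField_le G μ)
      (fun a : M => coordField a) μ := by
  classical
  have horb (a : M) : {c : M | ∃ g ∈ G, g a = c}.Infinite := by
    simpa using hnoalg ∅ finite_empty a (notMem_empty a)
  rw [iCondIndep_iff _ _ _ coordField_le]
  intro S
  induction S using Finset.induction_on with
  | empty =>
    intro f _
    simp [condExp_const (invariantField_le G μ)]
    rfl
  | insert a S ha ih =>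
    intro f hf
    have hfa := hf a (Finset.mem_insert_self a S)
    have hinf : ∃ x, x ≠ a := by
      obtain ⟨x, -, hx⟩ := (horb a).exists_notMem_finset {a}
      exact ⟨x, by simpa using hx⟩
    have hC : MeasurableSet[otherCoordsField a] (⋂ i ∈ S, f i) :=
      Finset.measurableSet_biInter _ fun i hi =>
        coordField_le_otherCoordsField (ne_of_mem_of_not_mem hi ha) _ (hf i (Finset.mem_insert_of_mem hi))
    have hφ : StronglyMeasurable[invariantField G μ] (μ⟦f a | otherCoordsField a⟧) :=
      (measurable_invariantField
        (stronglyMeasurable_condExp.mono (otherCoordsField_le a)).measurable fun g hg =>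
          condExp_otherCoordsField_comp_shiftAct hinv (hmax a) huna hinf hfa
            (G.inv_mem hg)).stronglyMeasurable
    have h1 := condExp_indicator_inter_of_stronglyMeasurable (otherCoordsField_le a)
      (invariantField_le G μ) (invariantField_le_eventuallyMeasurableSpace hinv (horb a))
      (coordField_le a _ hfa) hC hφ
    rw [Finset.set_biInter_insert, Finset.prod_insert ha]
    exact h1.trans (EventuallyEq.rfl.mul (ih fun i hi => hf i (Finset.mem_insert_of_mem hi)))
end
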